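/- Let N ≥ 1 and M ≥ N be natural numbers, let C ⊆ D be K-subspaces of A = K⟨x,y⟩ with A(N)·C ⊆ C, and define I[D] = { r ∈ D : A·r ⊆ D }. Let I be a two-sided ideal of A ⊗_K A such that I ⊆ C ⊗ A + A ⊗ C. Then (A_{≥M} ⊗ A_{≥M})·I ⊆ I[D] ⊗ A + A ⊗ I[D], where A_{≥M} = ∑_{k≥M} A(k). -/

import Mathlib

open TensorProduct

noncomputable section

/-- The free associative unital `K`-algebra on two generators `x, y`. -/
abbrev FA (K : Type) [Field K] : Type := FreeAlgebra K (Fin 2)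

/-- `gp K n` is `A(n)`, the span of the words of length `n` in the two generators. -/
def gp (K : Type) [Field K] (n : ℕ) : Submodule K (FA K) :=
  Submodule.span K {a : FA K | ∃ w : List (Fin 2), w.length = n ∧ a = (w.map (FreeAlgebra.ι K)).prod}

/-- The canonical image of `U ⊗[K] V` inside `A ⊗[K] A`. -/
def tp (K : Type) [Field K] (U V : Submodule K (FA K)) : Submodule K (FA K ⊗[K] FA K) :=
  Submodule.map₂ (TensorProduct.mk K (FA K) (FA K)) U V

/-- `I[D] = { r ∈ D : A·r ⊆ D }`, as a `K`-subspace of `A`. -/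
def Isub (K : Type) [Field K] (D : Submodule K (FA K)) : Submodule K (FA K) :=
  D ⊓ ⨅ v : FA K, Submodule.comap (LinearMap.mulLeft K v) D

/-- `A_{≥M} = ∑_{k ≥ M} A(k)`. -/
def sumGE (K : Type) [Field K] (M : ℕ) : Submodule K (FA K) :=
  ⨆ k : ℕ, gp K (M + k)

/-- Over a field, a tensor killed by all `f ⊗ g`, where `f` and `g` range over point-separating
families of functionals, is zero. -/
theorem tensor_eq_zero_of_separating {K V W : Type*} [Field K] [AddCommGroup V] [Module K V]
    [AddCommGroup W] [Module K W] (F : Set (V →ₗ[K] K)) (G : Set (W →ₗ[K] K))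
    (hF : ∀ v, (∀ f ∈ F, f v = 0) → v = 0) (hG : ∀ w, (∀ g ∈ G, g w = 0) → w = 0)
    (t : V ⊗[K] W) (h : ∀ f ∈ F, ∀ g ∈ G, TensorProduct.map f g t = 0) : t = 0 := by
  classical
  have h₁ : ∀ g ∈ G, g.lTensor V t = 0 := by
    intro g hg
    apply (TensorProduct.rid K V).injective
    rw [map_zero]
    refine hF _ fun f hf => ?_
    have key : f ∘ₗ (TensorProduct.rid K V).toLinearMap ∘ₗ g.lTensor V
        = (TensorProduct.rid K K).toLinearMap ∘ₗ TensorProduct.map f g := by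
      ext v w
      simp
    have := LinearMap.congr_fun key t
    simpa [h f hf g hg] using this
  apply (TensorProduct.equivFinsuppOfBasisLeft (N := W) (Module.Basis.ofVectorSpace K V)).injective
  rw [map_zero]
  ext i
  rw [TensorProduct.equivFinsuppOfBasisLeft_apply]
  refine hG _ fun g hg => ?_
  set c := (Module.Basis.ofVectorSpace K V).coord i
  have key : g ∘ₗ (TensorProduct.lid K W).toLinearMap ∘ₗ c.rTensor W
      = (TensorProduct.lid K K).toLinearMap ∘ₗ c.rTensor K ∘ₗ g.lTensor V := by
    ext v w
    simp
  have := LinearMap.congr_fun key t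
  simpa only [LinearMap.comp_apply, LinearEquiv.coe_coe, h₁ g hg, map_zero] using this

theorem mem_Isub {K : Type} [Field K] {D : Submodule K (FA K)} {r : FA K} :
    r ∈ Isub K D ↔ ∀ v, v * r ∈ D := by
  simp only [Isub, Submodule.mem_inf, Submodule.mem_iInf, Submodule.mem_comap,
    LinearMap.mulLeft_apply, and_iff_right_iff_imp]
  exact fun h => by simpa using h 1

/-- A pair of functionals vanishing on `D` kills `D ⊗ A + A ⊗ D`. -/
theorem map_eq_zero_of_mem_tp {K : Type} [Field K] {D : Submodule K (FA K)}
    {φ ψ : FA K →ₗ[K] K} (hφ : ∀ d ∈ D, φ d = 0) (hψ : ∀ d ∈ D, ψ d = 0)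
    {t : FA K ⊗[K] FA K} (ht : t ∈ tp K D ⊤ ⊔ tp K ⊤ D) : TensorProduct.map φ ψ t = 0 := by
  suffices tp K D ⊤ ⊔ tp K ⊤ D ≤ LinearMap.ker (TensorProduct.map φ ψ) from this ht
  refine sup_le (Submodule.map₂_le.2 fun a ha b _ => ?_) (Submodule.map₂_le.2 fun a _ b hb => ?_)
  · simp [hφ a ha]
  · simp [hψ b hb]

/-- The kernel of `A ⊗ A → A/B ⊗ A/B` is contained in `B ⊗ A + A ⊗ B`. -/
theorem mem_tp_of_map_mkQ_eq_zero {K : Type} [Field K] {B : Submodule K (FA K)}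
    {t : FA K ⊗[K] FA K} (ht : TensorProduct.map B.mkQ B.mkQ t = 0) :
    t ∈ tp K B ⊤ ⊔ tp K ⊤ B := by
  have hex : Function.Exact B.subtype B.mkQ := LinearMap.exact_subtype_mkQ B
  have hk := TensorProduct.map_ker hex B.mkQ_surjective hex B.mkQ_surjective
  have ht' : t ∈ LinearMap.ker (TensorProduct.map B.mkQ B.mkQ) := ht
  rw [hk] at ht'
  refine (sup_le ?_ ?_ : _ ≤ tp K B ⊤ ⊔ tp K ⊤ B) ht'
  · refine le_trans ?_ le_sup_right
    rintro _ ⟨s, rfl⟩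
    induction s with
    | zero => simp
    | tmul a b => exact Submodule.apply_mem_map₂ _ Submodule.mem_top b.2
    | add x y hx hy => rw [map_add]; exact add_mem hx hy
  · refine le_trans ?_ le_sup_left
    rintro _ ⟨s, rfl⟩
    induction s with
    | zero => simp
    | tmul a b => exact Submodule.apply_mem_map₂ _ a.2 Submodule.mem_top
    | add x y hx hy => rw [map_add]; exact add_mem hx hy

/-- A left ideal of `A ⊗ A` contained in `D ⊗ A + A ⊗ D` is contained in
`I[D] ⊗ A + A ⊗ I[D]`. -/
theorem le_tp_Isub_of_le_tp {K : Type} [Field K] {D : Submodule K (FA K)}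
    {I : Submodule K (FA K ⊗[K] FA K)}
    (hIl : (⊤ : Submodule K (FA K ⊗[K] FA K)) * I ≤ I) (hI : I ≤ tp K D ⊤ ⊔ tp K ⊤ D) :
    I ≤ tp K (Isub K D) ⊤ ⊔ tp K ⊤ (Isub K D) := by
  intro t ht
  apply mem_tp_of_map_mkQ_eq_zero
  let F : Set ((FA K ⧸ Isub K D) →ₗ[K] K) :=
    {f | ∃ (u : FA K) (φ : FA K →ₗ[K] K), (∀ d ∈ D, φ d = 0) ∧
      f ∘ₗ (Isub K D).mkQ = φ ∘ₗ LinearMap.mulLeft K u}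
  have hF : ∀ q, (∀ f ∈ F, f q = 0) → q = 0 := by
    intro q hq
    obtain ⟨r, rfl⟩ := (Isub K D).mkQ_surjective q
    rw [Submodule.mkQ_apply, Submodule.Quotient.mk_eq_zero, mem_Isub]
    intro u
    by_contra hu
    obtain ⟨φ, hφ, hφD⟩ := Submodule.exists_le_ker_of_notMem hu
    have hle : Isub K D ≤ LinearMap.ker (φ ∘ₗ LinearMap.mulLeft K u) := fun s hs =>
      hφD (mem_Isub.1 hs u)
    refine hφ ?_
    have := hq ((Isub K D).liftQ _ hle) ⟨u, φ, fun d hd => hφD hd, Submodule.liftQ_mkQ _ _ _⟩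
    simpa using this
  refine tensor_eq_zero_of_separating F F hF hF _ ?_
  rintro f ⟨u, φ, hφ, hf⟩ g ⟨v, ψ, hψ, hg⟩
  rw [← LinearMap.comp_apply, ← TensorProduct.map_comp, hf, hg, TensorProduct.map_comp,
    LinearMap.comp_apply]
  apply map_eq_zero_of_mem_tp hφ hψ
  have hmul : TensorProduct.map (LinearMap.mulLeft K u) (LinearMap.mulLeft K v)
      = LinearMap.mulLeft K (u ⊗ₜ[K] v) := by
    apply TensorProduct.ext'
    simp
  rw [hmul, LinearMap.mulLeft_apply]
  exact hI (hIl (Submodule.mul_mem_mul Submodule.mem_top ht))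

theorem statement19 (K : Type) [Field K] (N M : ℕ) (hN : 1 ≤ N) (hM : N ≤ M)
    (C D : Submodule K (FA K)) (hCD : C ≤ D)
    (hC : gp K N * C ≤ C)
    (I : Submodule K (FA K ⊗[K] FA K))
    (hIl : (⊤ : Submodule K (FA K ⊗[K] FA K)) * I ≤ I)
    (hIr : I * (⊤ : Submodule K (FA K ⊗[K] FA K)) ≤ I)
    (hI : I ≤ tp K C ⊤ ⊔ tp K ⊤ C) :
    tp K (sumGE K M) (sumGE K M) * I ≤ tp K (Isub K D) ⊤ ⊔ tp K ⊤ (Isub K D) := by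
  have hmono : tp K C ⊤ ⊔ tp K ⊤ C ≤ tp K D ⊤ ⊔ tp K ⊤ D :=
    sup_le_sup (Submodule.map₂_le_map₂ hCD le_rfl) (Submodule.map₂_le_map₂ le_rfl hCD)
  exact ((mul_le_mul' le_top le_rfl).trans hIl).trans
    (le_tp_Isub_of_le_tp hIl (hI.trans hmono))
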